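/- Let Λ be the path algebra of the Kronecker quiver over a field K, and let H be the additive closure of the set of preinjective modules {(n, n+1) : 0 ≤ n ≤ N} (indexed by dimension vectors) for some N. Then H is closed under quotients: every quotient of a module in H is again in H (up to isomorphism). -/

import Mathlib

/-! Representations of the Kronecker quiver (two vertices, two parallel arrows) over a
field `K`, as a stand-in for modules over the Kronecker path algebra `Λ = KQ`. -/

/-- A representation of the Kronecker quiver: two `K`-vector spaces and two linear maps. -/
structure KronRep (K : Type) [Field K] where
  V1 : Type
  V2 : Type
  [acg1 : AddCommGroup V1]
  [acg2 : AddCommGroup V2]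
  [mod1 : Module K V1]
  [mod2 : Module K V2]
  α : V2 →ₗ[K] V1
  β : V2 →ₗ[K] V1

attribute [instance] KronRep.acg1 KronRep.acg2 KronRep.mod1 KronRep.mod2

variable {K : Type} [Field K]

/-- A morphism of Kronecker representations. -/
structure KronHom (X Y : KronRep K) where
  t1 : X.V1 →ₗ[K] Y.V1
  t2 : X.V2 →ₗ[K] Y.V2
  commα : t1 ∘ₗ X.α = Y.α ∘ₗ t2
  commβ : t1 ∘ₗ X.β = Y.β ∘ₗ t2

/-- Two Kronecker representations are isomorphic if there is a morphism between them whose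
components are bijective. -/
def KronIso (X Y : KronRep K) : Prop :=
  ∃ φ : KronHom X Y, Function.Bijective φ.t1 ∧ Function.Bijective φ.t2

/-- The preinjective indecomposable representation with dimension vector `(n, n+1)`. -/
def preinj (K : Type) [Field K] (n : ℕ) : KronRep K where
  V1 := Fin n → K
  V2 := Fin (n + 1) → K
  α := LinearMap.funLeft K K Fin.castSucc
  β := LinearMap.funLeft K K Fin.succ

/-- The finite direct sum of a family of Kronecker representations. -/
def sumRep {m : ℕ} (W : Fin m → KronRep K) : KronRep K where
  V1 := ∀ i, (W i).V1
  V2 := ∀ i, (W i).V2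
  α := LinearMap.pi fun i => (W i).α ∘ₗ LinearMap.proj i
  β := LinearMap.pi fun i => (W i).β ∘ₗ LinearMap.proj i

/-- Membership in `H = add {(n, n+1) : 0 ≤ n ≤ N}`: isomorphism with a finite direct sum of
preinjectives `(n, n+1)` with `n ≤ N`. -/
def memAddH (N : ℕ) (X : KronRep K) : Prop :=
  ∃ (m : ℕ) (d : Fin m → ℕ), (∀ i, d i ≤ N) ∧ KronIso X (sumRep fun i => preinj K (d i))


namespace KronAux

open Module

section chains

variable {V W : Type} [AddCommGroup V] [AddCommGroup W] [Module K V] [Module K W]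

/-- Sequences supported in `[0, l)`. -/
def supp (K V : Type) [Field K] [AddCommGroup V] [Module K V] (l : ℕ) : Submodule K (ℕ → V) where
  carrier := {c | ∀ i, l ≤ i → c i = 0}
  add_mem' := by
    intro a b ha hb i hi
    simp [ha i hi, hb i hi]
  zero_mem' := by intro i _; rfl
  smul_mem' := by
    intro r a ha i hi
    simp [ha i hi]

/-- The shift. -/
def shift (K V : Type) [Field K] [AddCommGroup V] [Module K V] : (ℕ → V) →ₗ[K] (ℕ → V) where
  toFun c := fun i => Nat.casesOn i 0 c
  map_add' := by
    intro a b
    funext i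
    cases i <;> simp
  map_smul' := by
    intro a b
    funext i
    cases i <;> simp

@[simp] lemma shift_zero (c : ℕ → V) : shift K V c 0 = 0 := rfl
@[simp] lemma shift_succ (c : ℕ → V) (i : ℕ) : shift K V c (i + 1) = c i := rfl

lemma shift_inj : Function.Injective (shift K V) := by
  intro a b h
  funext i
  simpa using congrFun h (i + 1)

/-- Pointwise application. -/
def mapSeq (f : V →ₗ[K] W) : (ℕ → V) →ₗ[K] (ℕ → W) where
  toFun c := fun i => f (c i)
  map_add' := by intro a b; funext i; simp
  map_smul' := by intro a b; funext i; simp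

@[simp] lemma mapSeq_apply (f : V →ₗ[K] W) (c : ℕ → V) (i : ℕ) : mapSeq f c i = f (c i) := rfl

/-- The pencil `t α - β`. -/
def pencil (α β : V →ₗ[K] W) : (ℕ → V) →ₗ[K] (ℕ → W) :=
  shift K W ∘ₗ mapSeq α - mapSeq β

@[simp] lemma pencil_zero (α β : V →ₗ[K] W) (c : ℕ → V) : pencil α β c 0 = - β (c 0) := by
  simp [pencil]
@[simp] lemma pencil_succ (α β : V →ₗ[K] W) (c : ℕ → V) (i : ℕ) :
    pencil α β c (i + 1) = α (c i) - β (c (i + 1)) := by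
  simp [pencil]

/-- Chains of length `l`. -/
def chain (α β : V →ₗ[K] W) (l : ℕ) : Submodule K (ℕ → V) :=
  supp K V l ⊓ LinearMap.ker (pencil α β)

lemma mem_chain {α β : V →ₗ[K] W} {l : ℕ} {c : ℕ → V} :
    c ∈ chain α β l ↔ (∀ i, l ≤ i → c i = 0) ∧ β (c 0) = 0 ∧ ∀ i, α (c i) = β (c (i + 1)) := by
  unfold chain
  rw [Submodule.mem_inf, LinearMap.mem_ker]
  refine and_congr Iff.rfl ?_
  constructor
  · intro h
    refine ⟨by simpa using congrFun h 0, fun i => ?_⟩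
    have := congrFun h (i + 1)
    rw [pencil_succ] at this
    exact sub_eq_zero.mp this
  · rintro ⟨h0, h⟩
    funext i
    cases i with
    | zero => simp [h0]
    | succ i => simp [h i]

/-- Sequences supported in `[0,l)` are tuples. -/
def suppEquiv (K V : Type) [Field K] [AddCommGroup V] [Module K V] (l : ℕ) :
    supp K V l ≃ₗ[K] (Fin l → V) where
  toFun c := fun i => c.1 i
  invFun f := ⟨fun i => if h : i < l then f ⟨i, h⟩ else 0, by
    intro i hi
    simp [not_lt.mpr hi]⟩
  map_add' := by intro a b; rfl
  map_smul' := by intro a b; rfl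
  left_inv := by
    intro c
    ext i
    by_cases h : i < l
    · simp [h]
    · simp [h, c.2 i (not_lt.mp h)]
  right_inv := by
    intro f
    funext i
    simp

instance [FiniteDimensional K V] (l : ℕ) : FiniteDimensional K (supp K V l) :=
  (suppEquiv K V l).symm.finiteDimensional

lemma finrank_supp [FiniteDimensional K V] (l : ℕ) :
    finrank K (supp K V l) = l * finrank K V := by
  rw [(suppEquiv K V l).finrank_eq, Module.finrank_pi_fintype]
  simp

instance [FiniteDimensional K V] (α β : V →ₗ[K] W) (l : ℕ) :
    FiniteDimensional K (chain α β l) :=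
  Submodule.finiteDimensional_of_le (inf_le_left : chain α β l ≤ supp K V l)

lemma pencil_mem_supp (α β : V →ₗ[K] W) (l : ℕ) (c : ℕ → V) (hc : c ∈ supp K V l) :
    pencil α β c ∈ supp K W (l + 1) := by
  intro i hi
  cases i with
  | zero => omega
  | succ i => simp [hc i (by omega), hc (i + 1) (by omega)]

/-- The vanishing of `Ext`. -/
def PSurj (α β : V →ₗ[K] W) (l : ℕ) : Prop :=
  ∀ f ∈ supp K W (l + 1), ∃ c ∈ supp K V l, pencil α β c = f

lemma finrank_chain [FiniteDimensional K V] [FiniteDimensional K W]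
    (α β : V →ₗ[K] W) (l : ℕ) (h : PSurj α β l) :
    finrank K (chain α β l) + (l + 1) * finrank K W = l * finrank K V := by
  have h1 := LinearMap.finrank_range_add_finrank_ker ((pencil α β).domRestrict (supp K V l))
  have h2 : LinearMap.range ((pencil α β).domRestrict (supp K V l)) = supp K W (l + 1) := by
    ext f
    constructor
    · rintro ⟨c, rfl⟩
      exact pencil_mem_supp α β l c.1 c.2
    · intro hf
      obtain ⟨c, hc, rfl⟩ := h f hf
      exact ⟨⟨c, hc⟩, rfl⟩
  have h3 : finrank K (LinearMap.ker ((pencil α β).domRestrict (supp K V l)))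
      = finrank K (chain α β l) := by
    have : (LinearMap.ker ((pencil α β).domRestrict (supp K V l))).map (supp K V l).subtype
        = chain α β l := by
      ext c
      simp [chain, LinearMap.domRestrict, and_comm]
    rw [← this]
    exact (LinearEquiv.finrank_eq
      (Submodule.equivMapOfInjective _ (Submodule.subtype_injective _) _))
  rw [h2, h3, finrank_supp, finrank_supp] at h1
  omega

lemma chain_mono (α β : V →ₗ[K] W) (l : ℕ) : chain α β l ≤ chain α β (l + 1) := by
  intro c hc
  rw [mem_chain] at *
  exact ⟨fun i hi => hc.1 i (by omega), hc.2⟩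

lemma chain_mono' (α β : V →ₗ[K] W) {l l' : ℕ} (h : l ≤ l') : chain α β l ≤ chain α β l' := by
  intro c hc
  rw [mem_chain] at *
  exact ⟨fun i hi => hc.1 i (by omega), hc.2⟩

lemma chain_shift (α β : V →ₗ[K] W) (l : ℕ) :
    (chain α β l).map (shift K V) ≤ chain α β (l + 1) := by
  rintro _ ⟨c, hc, rfl⟩
  rw [SetLike.mem_coe, mem_chain] at hc
  rw [mem_chain]
  refine ⟨fun i hi => ?_, by simp, fun i => ?_⟩
  · cases i with
    | zero => rfl
    | succ i => exact hc.1 i (by omega)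
  · cases i with
    | zero => simp [hc.2.1]
    | succ i => exact hc.2.2 i

lemma chain_inf (α β : V →ₗ[K] W) (l : ℕ) :
    chain α β (l + 1) ⊓ (chain α β (l + 1)).map (shift K V) = (chain α β l).map (shift K V) := by
  apply le_antisymm
  · rintro _ ⟨h1, ⟨c, hc, rfl⟩⟩
    rw [SetLike.mem_coe, mem_chain] at h1 hc
    refine ⟨c, ?_, rfl⟩
    rw [SetLike.mem_coe, mem_chain]
    exact ⟨fun i hi => h1.1 (i + 1) (by omega), hc.2⟩
  · exact le_inf (chain_shift α β l) (Submodule.map_mono (chain_mono α β l))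

lemma chain_zero (α β : V →ₗ[K] W) : chain α β 0 = ⊥ := by
  rw [eq_bot_iff]
  intro c hc
  rw [mem_chain] at hc
  rw [Submodule.mem_bot]
  funext i
  exact hc.1 i (by omega)

/-- Old chains. -/
def old (α β : V →ₗ[K] W) (l : ℕ) : Submodule K (ℕ → V) :=
  chain α β l ⊔ (chain α β l).map (shift K V)

lemma old_le (α β : V →ₗ[K] W) (l : ℕ) : old α β l ≤ chain α β (l + 1) :=
  sup_le (chain_mono α β l) (chain_shift α β l)

lemma exists_new (α β : V →ₗ[K] W) (l : ℕ) :
    ∃ G : Submodule K (ℕ → V), old α β l ⊔ G = chain α β (l + 1) ∧ old α β l ⊓ G = ⊥ := by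
  obtain ⟨C, hC⟩ := exists_isCompl (old α β l)
  refine ⟨C ⊓ chain α β (l + 1), ?_, ?_⟩
  · rw [← sup_inf_assoc_of_le _ (old_le α β l), hC.sup_eq_top, top_inf_eq]
  · rw [← inf_assoc, hC.inf_eq_bot, bot_inf_eq]

/-- New chains. -/
noncomputable def new (α β : V →ₗ[K] W) (l : ℕ) : Submodule K (ℕ → V) :=
  (exists_new α β l).choose

lemma new_sup (α β : V →ₗ[K] W) (l : ℕ) : old α β l ⊔ new α β l = chain α β (l + 1) :=
  (exists_new α β l).choose_spec.1

lemma new_inf (α β : V →ₗ[K] W) (l : ℕ) : old α β l ⊓ new α β l = ⊥ :=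
  (exists_new α β l).choose_spec.2

lemma new_le (α β : V →ₗ[K] W) (l : ℕ) : new α β l ≤ chain α β (l + 1) :=
  (new_sup α β l) ▸ le_sup_right

instance [FiniteDimensional K V] (α β : V →ₗ[K] W) (l : ℕ) :
    FiniteDimensional K (new α β l) :=
  Submodule.finiteDimensional_of_le (new_le α β l)

instance [FiniteDimensional K V] (α β : V →ₗ[K] W) (l : ℕ) :
    FiniteDimensional K (old α β l) :=
  Submodule.finiteDimensional_of_le (old_le α β l)

lemma finrank_new [FiniteDimensional K V] (α β : V →ₗ[K] W) (l : ℕ) :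
    finrank K (chain α β (l + 1)) = finrank K (old α β l) + finrank K (new α β l) := by
  have := Submodule.finrank_sup_add_finrank_inf_eq (old α β l) (new α β l)
  rw [new_sup, new_inf, finrank_bot] at this
  omega

lemma finrank_shift (U : Submodule K (ℕ → V)) :
    finrank K (U.map (shift K V)) = finrank K U :=
  (LinearEquiv.finrank_eq (Submodule.equivMapOfInjective _ shift_inj U)).symm

lemma finrank_old [FiniteDimensional K V] (α β : V →ₗ[K] W) (l : ℕ) :
    finrank K (old α β (l + 1)) + finrank K (chain α β l) = 2 * finrank K (chain α β (l + 1)) := by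
  have := Submodule.finrank_sup_add_finrank_inf_eq (chain α β (l + 1))
    ((chain α β (l + 1)).map (shift K V))
  rw [chain_inf, finrank_shift, finrank_shift] at this
  unfold old
  omega

lemma rec_new [FiniteDimensional K V] (α β : V →ₗ[K] W) (l : ℕ) :
    (finrank K (new α β (l + 1)) : ℤ) = finrank K (chain α β (l + 2))
      - 2 * finrank K (chain α β (l + 1)) + finrank K (chain α β l) := by
  have h1 := finrank_new α β (l + 1)
  have h2 := finrank_old α β l
  rw [show l + 1 + 1 = l + 2 from rfl] at h1
  omega

lemma rec_zero [FiniteDimensional K V] (α β : V →ₗ[K] W) :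
    finrank K (new α β 0) = finrank K (chain α β 1) := by
  have h1 := finrank_new α β 0
  have : old α β 0 = ⊥ := by simp [old, chain_zero]
  rw [this, finrank_bot] at h1
  simpa using h1.symm

lemma sum_new [FiniteDimensional K V] (α β : V →ₗ[K] W) (l : ℕ) :
    ∑ k ∈ Finset.range (l + 1), (finrank K (new α β k) : ℤ)
      = finrank K (chain α β (l + 1)) - finrank K (chain α β l) := by
  induction l with
  | zero =>
    have : finrank K (chain α β 0) = 0 := by rw [chain_zero, finrank_bot]
    simp [rec_zero, this]
  | succ l ih => rw [Finset.sum_range_succ, ih, rec_new]; ring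

lemma sum_mul_new [FiniteDimensional K V] (α β : V →ₗ[K] W) (l : ℕ) :
    ∑ k ∈ Finset.range (l + 1), (finrank K (new α β k) : ℤ) * k
      = l * finrank K (chain α β (l + 1)) - (l + 1) * finrank K (chain α β l) := by
  induction l with
  | zero =>
    have : finrank K (chain α β 0) = 0 := by rw [chain_zero, finrank_bot]
    simp [this]
  | succ l ih => rw [Finset.sum_range_succ, ih, rec_new]; push_cast; ring

lemma totals [FiniteDimensional K V] [FiniteDimensional K W] (α β : V →ₗ[K] W) (N : ℕ)
    (h : PSurj α β N) (h' : PSurj α β (N + 1)) :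
    ∑ k ∈ Finset.range (N + 1), finrank K (new α β k) * k = finrank K W ∧
    ∑ k ∈ Finset.range (N + 1), finrank K (new α β k) * (k + 1) = finrank K V := by
  have e1 := finrank_chain α β N h
  have e2 := finrank_chain α β (N + 1) h'
  have s1 := sum_new α β N
  have s2 := sum_mul_new α β N
  zify at e1 e2
  have a : ∑ k ∈ Finset.range (N + 1), (finrank K (new α β k) : ℤ) * k = finrank K W := by
    rw [s2, eq_sub_of_add_eq e1, eq_sub_of_add_eq e2]; ring
  constructor
  · exact_mod_cast a
  · have : ∑ k ∈ Finset.range (N + 1), (finrank K (new α β k) : ℤ) * (k + 1) = finrank K V := by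
      simp only [mul_add, mul_one, Finset.sum_add_distrib]
      rw [a, s1, eq_sub_of_add_eq e1, eq_sub_of_add_eq e2]; ring
    exact_mod_cast this

/-- If the new chains have coefficients in `R`, so do all chains. -/
lemma chain_coeff (α β : V →ₗ[K] W) (N : ℕ) (R : Submodule K V)
    (h : ∀ l ≤ N, ∀ c ∈ new α β l, ∀ i, c i ∈ R) :
    ∀ l ≤ N + 1, ∀ c ∈ chain α β l, ∀ i, c i ∈ R := by
  intro l
  induction l with
  | zero =>
    intro _ c hc i
    rw [chain_zero, Submodule.mem_bot] at hc
    simp [hc]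
  | succ l ih =>
    intro hl c hc i
    rw [← new_sup] at hc
    obtain ⟨a, ha, b, hb, rfl⟩ := Submodule.mem_sup.mp hc
    obtain ⟨a1, ha1, a2, ⟨a3, ha3, rfl⟩, rfl⟩ := Submodule.mem_sup.mp ha
    refine R.add_mem (R.add_mem (ih (by omega) _ ha1 i) ?_) (h l (by omega) b hb i)
    cases i with
    | zero => simp
    | succ i => exact ih (by omega) _ ha3 i

end chains

section reps

/-- Composition. -/
def comp {X Y Z : KronRep K} (g : KronHom Y Z) (f : KronHom X Y) : KronHom X Z where
  t1 := g.t1 ∘ₗ f.t1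
  t2 := g.t2 ∘ₗ f.t2
  commα := by rw [LinearMap.comp_assoc, f.commα, ← LinearMap.comp_assoc, g.commα]; rfl
  commβ := by rw [LinearMap.comp_assoc, f.commβ, ← LinearMap.comp_assoc, g.commβ]; rfl

lemma iso_symm {X Y : KronRep K} (h : KronIso X Y) : KronIso Y X := by
  obtain ⟨φ, h1, h2⟩ := h
  let e1 := LinearEquiv.ofBijective φ.t1 h1
  let e2 := LinearEquiv.ofBijective φ.t2 h2
  refine ⟨⟨e1.symm.toLinearMap, e2.symm.toLinearMap, ?_, ?_⟩, e1.symm.bijective, e2.symm.bijective⟩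
  · ext y
    obtain ⟨x, rfl⟩ := e2.surjective y
    have := LinearMap.congr_fun φ.commα x
    apply e1.injective
    simp only [LinearMap.comp_apply, LinearEquiv.coe_coe, LinearEquiv.apply_symm_apply,
      LinearEquiv.symm_apply_apply]
    exact this.symm
  · ext y
    obtain ⟨x, rfl⟩ := e2.surjective y
    have := LinearMap.congr_fun φ.commβ x
    apply e1.injective
    simp only [LinearMap.comp_apply, LinearEquiv.coe_coe, LinearEquiv.apply_symm_apply,
      LinearEquiv.symm_apply_apply]
    exact this.symm

lemma map_chain {X Y : KronRep K} (φ : KronHom X Y) {l : ℕ} {c : ℕ → X.V2}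
    (hc : c ∈ chain X.α X.β l) : mapSeq φ.t2 c ∈ chain Y.α Y.β l := by
  rw [mem_chain] at *
  have ha := fun x => LinearMap.congr_fun φ.commα x
  have hb := fun x => LinearMap.congr_fun φ.commβ x
  simp only [LinearMap.comp_apply] at ha hb
  refine ⟨fun i hi => by simp [hc.1 i hi], ?_, fun i => ?_⟩
  · rw [mapSeq_apply, ← hb, hc.2.1, map_zero]
  · rw [mapSeq_apply, mapSeq_apply, ← hb, ← ha, hc.2.2]

lemma psurj_of_surj {X Y : KronRep K} (φ : KronHom X Y)
    (h1 : Function.Surjective φ.t1) {l : ℕ} (h : PSurj X.α X.β l) : PSurj Y.α Y.β l := by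
  have ha := fun x => LinearMap.congr_fun φ.commα x
  have hb := fun x => LinearMap.congr_fun φ.commβ x
  simp only [LinearMap.comp_apply] at ha hb
  intro f hf
  choose s hs using h1
  obtain ⟨c, hc, hcf⟩ := h (fun i => if i < l + 1 then s (f i) else 0)
    (fun i hi => by simp [not_lt.mpr hi])
  refine ⟨mapSeq φ.t2 c, fun i hi => by simp [hc i hi], ?_⟩
  have key : pencil Y.α Y.β (mapSeq φ.t2 c) = mapSeq φ.t1 (pencil X.α X.β c) := by
    funext i
    cases i with
    | zero => simp [hb]
    | succ i => simp [ha, hb]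
  rw [key, hcf]
  funext i
  by_cases hi : i < l + 1
  · rw [mapSeq_apply, if_pos hi, hs]
  · rw [mapSeq_apply, if_neg hi, map_zero, hf i (not_lt.mp hi)]

lemma psurj_sum {m : ℕ} (X : Fin m → KronRep K) (l : ℕ)
    (h : ∀ p, PSurj (X p).α (X p).β l) : PSurj (sumRep X).α (sumRep X).β l := by
  intro f hf
  have : ∀ p, ∃ c ∈ supp K (X p).V2 l, pencil (X p).α (X p).β c = fun i => f i p := by
    intro p
    apply h p
    intro i hi
    exact congrFun (hf i hi) p
  choose c hc hcf using this
  let C : ℕ → (sumRep X).V2 := fun i p => c p i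
  refine ⟨C, fun i hi => funext fun p => hc p i hi, ?_⟩
  funext i
  funext p
  rw [← congrFun (hcf p) i]
  cases i with
  | zero =>
    exact (congrFun (pencil_zero (sumRep X).α (sumRep X).β C) p).trans
      (pencil_zero (X p).α (X p).β (c p)).symm
  | succ i =>
    exact (congrFun (pencil_succ (sumRep X).α (sumRep X).β C i) p).trans
      (pencil_succ (X p).α (X p).β (c p) i).symm

/-- Solution below the diagonal. -/
def solA (F : ℕ → ℕ → K) : ℕ → ℕ → K
  | 0, i => - F 0 (i - 1)
  | _ + 1, 0 => 0
  | j + 1, i + 1 => solA F j i - F (j + 1) i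

lemma psurj_preinj (n l : ℕ) (hl : n ≤ l) : PSurj (preinj K n).α (preinj K n).β l := by
  intro f hf
  let F : ℕ → ℕ → K := fun j i => if h : i < n then (f j : Fin n → K) ⟨i, h⟩ else 0
  have hF0 : ∀ j i, n ≤ i → F j i = 0 := fun j i h => by simp [F, not_lt.mpr h]
  have hFl : ∀ j i, l + 1 ≤ j → F j i = 0 := fun j i h => by
    by_cases hi : i < n
    · simp only [F, hi, dite_true]; exact congrFun (hf j h) _
    · simp [F, hi]
  have hF : ∀ j (i : Fin n), (f j : Fin n → K) i = F j i := fun j i => by simp [F]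
  let B : ℕ → ℕ → K := fun j i => ∑ s ∈ Finset.range n, F (j + 1 + s) (i + s)
  have hB : ∀ j i, B j i = F (j + 1) i + B (j + 1) (i + 1) := by
    intro j i
    have e1 := Finset.sum_range_succ (fun s => F (j + 1 + s) (i + s)) n
    have e2 := Finset.sum_range_succ' (fun s => F (j + 1 + s) (i + s)) n
    rw [e1, hF0 _ (i + n) (by omega)] at e2
    simp only [add_zero] at e2
    simp only [B]
    rw [e2, add_comm]
    congr 1
    refine Finset.sum_congr rfl fun s _ => ?_
    congr 1 <;> ring
  have hB0 : ∀ j i, l ≤ j → B j i = 0 := fun j i h =>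
    Finset.sum_eq_zero fun s _ => hFl _ _ (by omega)
  let v : ℕ → ℕ → K := fun j i => if j < l then (if i ≤ j then B j i else solA F j i) else 0
  let c : ℕ → (preinj K n).V2 := fun j => (fun i : Fin (n + 1) => v j i : Fin (n + 1) → K)
  refine ⟨c, fun j hj => ?_, ?_⟩
  · funext i
    show v j i = 0
    simp [v, not_lt.mpr hj]
  · funext j
    cases j with
    | zero =>
      rw [pencil_zero]
      funext i
      show - v 0 ((i : ℕ) + 1) = (f 0 : Fin n → K) i
      rw [hF]
      have := i.2
      simp [v, solA, show 0 < l by omega]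
    | succ j =>
      rw [pencil_succ]
      funext i
      show v j i - v (j + 1) ((i : ℕ) + 1) = (f (j + 1) : Fin n → K) i
      rw [hF]
      have hi := i.2
      by_cases hij : (i : ℕ) ≤ j
      · have a : v j i = B j i := by
          by_cases hj : j < l
          · simp [v, hij, hj]
          · simp [v, hj, hB0 j i (not_lt.mp hj)]
        have b : v (j + 1) ((i : ℕ) + 1) = B (j + 1) (i + 1) := by
          by_cases hj : j + 1 < l
          · simp [v, hij, hj]
          · simp [v, hj, hB0 (j + 1) (i + 1) (not_lt.mp hj)]
        rw [a, b, hB]; ring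
      · have hj : j < l := by omega
        have hj' : j + 1 < l := by omega
        simp [v, hij, hj, hj', solA]

/-- Sum of linear combinations. -/
noncomputable def combo {V : Type} [AddCommGroup V] [Module K V] {m : ℕ} (d : Fin m → ℕ)
    (c : Fin m → ℕ → V) : (∀ p, Fin (d p) → K) →ₗ[K] V :=
  ∑ p, (Fintype.linearCombination K (fun i : Fin (d p) => c p i)) ∘ₗ LinearMap.proj p

lemma combo_apply {V : Type} [AddCommGroup V] [Module K V] {m : ℕ} (d : Fin m → ℕ)
    (c : Fin m → ℕ → V) (x : ∀ p, Fin (d p) → K) :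
    combo d c x = ∑ p, ∑ i : Fin (d p), x p i • c p i := by
  simp [combo, Fintype.linearCombination_apply]

lemma combo_single {V : Type} [AddCommGroup V] [Module K V] {m : ℕ} (d : Fin m → ℕ)
    (c : Fin m → ℕ → V) (p : Fin m) (i : Fin (d p)) :
    combo d c (Pi.single p (Pi.single i (1 : K))) = c p i := by
  rw [combo_apply, Finset.sum_eq_single p]
  · rw [Finset.sum_eq_single i]
    · simp
    · intro j _ hj
      simp [Pi.single_eq_of_ne hj]
    · simp
  · intro q _ hq
    simp [Pi.single_eq_of_ne hq]
  · simp

/-- The map from a sum of preinjectives given by chains. -/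
noncomputable def ofChains (Y : KronRep K) {m : ℕ} (d : Fin m → ℕ) (c : Fin m → ℕ → Y.V2)
    (hc : ∀ p, c p ∈ chain Y.α Y.β (d p + 1)) :
    KronHom (sumRep fun p => preinj K (d p)) Y where
  t1 := combo d (fun p i => Y.α (c p i))
  t2 := combo (fun p => d p + 1) c
  commα := by
    apply LinearMap.ext
    intro (x : ∀ p, Fin (d p + 1) → K)
    have hl : ∀ p, Y.α (c p (d p)) = 0 := fun p => by
      have := mem_chain.mp (hc p)
      rw [this.2.2, this.1 _ le_rfl, map_zero]
    show combo d (fun p i => Y.α (c p i)) (fun p i => x p (Fin.castSucc i))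
      = Y.α (combo (fun p => d p + 1) c x)
    simp only [combo_apply, map_sum, map_smul]
    refine Finset.sum_congr rfl fun p _ => ?_
    rw [Fin.sum_univ_castSucc]
    simp only [Fin.val_last, hl, smul_zero, add_zero, Fin.val_castSucc]
  commβ := by
    apply LinearMap.ext
    intro (x : ∀ p, Fin (d p + 1) → K)
    show combo d (fun p i => Y.α (c p i)) (fun p i => x p (Fin.succ i))
      = Y.β (combo (fun p => d p + 1) c x)
    simp only [combo_apply, map_sum, map_smul]
    refine Finset.sum_congr rfl fun p _ => ?_
    have := mem_chain.mp (hc p)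
    rw [Fin.sum_univ_succ]
    simp only [Fin.val_zero, this.2.1, smul_zero, zero_add, Fin.val_succ, this.2.2]

lemma ofChains_mem (Y : KronRep K) {m : ℕ} (d : Fin m → ℕ) (c : Fin m → ℕ → Y.V2)
    (hc : ∀ p, c p ∈ chain Y.α Y.β (d p + 1)) (p : Fin m) (i : ℕ) :
    c p i ∈ LinearMap.range (ofChains Y d c hc).t2 := by
  by_cases hi : i < d p + 1
  · exact ⟨(Pi.single p (Pi.single ⟨i, hi⟩ 1) : ∀ p, Fin (d p + 1) → K),
      combo_single (fun p => d p + 1) c p ⟨i, hi⟩⟩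
  · rw [(mem_chain.mp (hc p)).1 i (by omega)]
    exact zero_mem _

lemma sum_alpha_surj {m : ℕ} (d : Fin m → ℕ) :
    Function.Surjective (sumRep fun p => preinj K (d p)).α := by
  intro y
  have : ∀ p, ∃ x, (preinj K (d p)).α x = y p := fun p =>
    LinearMap.funLeft_surjective_of_injective K K _ (Fin.castSucc_injective _) (y p)
  choose x hx using this
  exact ⟨x, funext hx⟩

/-- The tautological chain. -/
lemma taut_chain {m : ℕ} (d : Fin m → ℕ) (p : Fin m) :
    (fun i => (Pi.single p (fun j : Fin (d p + 1) => if (j : ℕ) = i then 1 else 0) :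
      ∀ p, Fin (d p + 1) → K)) ∈
      chain (sumRep fun p => preinj K (d p)).α (sumRep fun p => preinj K (d p)).β (d p + 1) := by
  refine mem_chain.mpr ⟨fun i hi => ?_, ?_, fun i => ?_⟩
  · have : (fun j : Fin (d p + 1) => if (j : ℕ) = i then (1 : K) else 0) = 0 := by
      funext j
      have := j.2
      simp [show (j : ℕ) ≠ i by omega]
    show (Pi.single p (fun j : Fin (d p + 1) => if (j : ℕ) = i then (1 : K) else 0) :
      ∀ p, Fin (d p + 1) → K) = 0
    rw [this, Pi.single_zero]
  · funext q
    funext j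
    show (Pi.single p (fun j : Fin (d p + 1) => if (j : ℕ) = 0 then (1 : K) else 0) :
      ∀ p, Fin (d p + 1) → K) q (Fin.succ j) = 0
    by_cases hq : q = p
    · subst hq
      simp
    · rw [Pi.single_eq_of_ne hq]; rfl
  · funext q
    funext j
    show (Pi.single p (fun j : Fin (d p + 1) => if (j : ℕ) = i then (1 : K) else 0) :
      ∀ p, Fin (d p + 1) → K) q (Fin.castSucc j) =
      (Pi.single p (fun j : Fin (d p + 1) => if (j : ℕ) = i + 1 then (1 : K) else 0) :
      ∀ p, Fin (d p + 1) → K) q (Fin.succ j)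
    by_cases hq : q = p
    · subst hq
      simp
    · rw [Pi.single_eq_of_ne hq, Pi.single_eq_of_ne hq]; rfl

/-- Coefficients of chains span a quotient. -/
lemma span_quot {m : ℕ} (d : Fin m → ℕ) (N : ℕ) (hd : ∀ p, d p ≤ N) (Y : KronRep K)
    (φ : KronHom (sumRep fun p => preinj K (d p)) Y) (h2 : Function.Surjective φ.t2)
    (R : Submodule K Y.V2) (hR : ∀ c ∈ chain Y.α Y.β (N + 1), ∀ i, c i ∈ R) : R = ⊤ := by
  rw [eq_top_iff]
  intro y _
  obtain ⟨x, rfl⟩ := h2 y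
  change ∀ p, Fin (d p + 1) → K at x
  have hx : x = ∑ p, ∑ i : Fin (d p + 1), x p i •
      (Pi.single p (fun j : Fin (d p + 1) => if (j : ℕ) = (i : ℕ) then 1 else 0) :
      ∀ p, Fin (d p + 1) → K) := by
    funext q
    funext j
    simp only [Finset.sum_apply, Pi.smul_apply]
    rw [Finset.sum_eq_single q]
    · simp [Fin.val_inj]
    · intro p _ hp
      simp [Pi.single_eq_of_ne (Ne.symm hp)]
    · simp
  have key : ∀ p (i : ℕ), φ.t2
      (Pi.single p (fun j : Fin (d p + 1) => if (j : ℕ) = (i : ℕ) then 1 else 0) :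
      ∀ p, Fin (d p + 1) → K) ∈ R := fun p i =>
    hR _ (chain_mono' _ _ (Nat.succ_le_succ (hd p)) (map_chain φ (taut_chain d p))) i
  rw [hx]
  have e := map_sum φ.t2 (fun p => (∑ i : Fin (d p + 1), x p i •
      (Pi.single p (fun j : Fin (d p + 1) => if (j : ℕ) = (i : ℕ) then 1 else 0) :
      ∀ p, Fin (d p + 1) → K) : ∀ p, Fin (d p + 1) → K)) Finset.univ
  refine (congrArg (· ∈ R) e).mpr ?_
  refine R.sum_mem fun p _ => ?_
  have e := map_sum φ.t2 (fun i : Fin (d p + 1) => (x p i •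
      (Pi.single p (fun j : Fin (d p + 1) => if (j : ℕ) = (i : ℕ) then 1 else 0) :
      ∀ p, Fin (d p + 1) → K) : ∀ p, Fin (d p + 1) → K)) Finset.univ
  refine (congrArg (· ∈ R) e).mpr ?_
  refine R.sum_mem fun i _ => ?_
  refine (congrArg (· ∈ R) (map_smul φ.t2 (x p i) _)).mpr ?_
  exact R.smul_mem _ (key p i)

lemma main (N : ℕ) {m : ℕ} (d : Fin m → ℕ) (hd : ∀ p, d p ≤ N) (Y : KronRep K)
    (φ : KronHom (sumRep fun p => preinj K (d p)) Y)
    (h1 : Function.Surjective φ.t1) (h2 : Function.Surjective φ.t2) : memAddH N Y := by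
  have f1 : FiniteDimensional K (sumRep fun p => preinj K (d p)).V1 :=
    inferInstanceAs (FiniteDimensional K (∀ p, Fin (d p) → K))
  have f2 : FiniteDimensional K (sumRep fun p => preinj K (d p)).V2 :=
    inferInstanceAs (FiniteDimensional K (∀ p, Fin (d p + 1) → K))
  have : FiniteDimensional K Y.V1 := Module.Finite.of_surjective φ.t1 h1
  have : FiniteDimensional K Y.V2 := Module.Finite.of_surjective φ.t2 h2
  have hP : ∀ l, N ≤ l → PSurj Y.α Y.β l := fun l hl =>
    psurj_of_surj φ h1 (psurj_sum _ l fun p => psurj_preinj _ _ ((hd p).trans hl))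
  obtain ⟨t1, t2⟩ := totals Y.α Y.β N (hP N le_rfl) (hP (N + 1) (by omega))
  let I := Σ l : Fin (N + 1), Fin (finrank K (new Y.α Y.β l))
  let e : Fin (Fintype.card I) ≃ I := (Fintype.equivFin I).symm
  let d' : Fin (Fintype.card I) → ℕ := fun p => (e p).1
  let c' : Fin (Fintype.card I) → ℕ → Y.V2 := fun p =>
    (Module.finBasis K (new Y.α Y.β (e p).1) (e p).2).1
  have hc' : ∀ p, c' p ∈ chain Y.α Y.β (d' p + 1) := fun p =>
    new_le _ _ _ (Module.finBasis K (new Y.α Y.β (e p).1) (e p).2).2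
  let ψ := ofChains Y d' c' hc'
  have hsum : ∀ g : ℕ → ℕ, ∑ p, g (d' p)
      = ∑ k ∈ Finset.range (N + 1), finrank K (new Y.α Y.β k) * g k := by
    intro g
    rw [e.sum_comp (fun q : I => g q.1), Fintype.sum_sigma, Finset.sum_range]
    simp
  have s2 : Function.Surjective ψ.t2 := by
    rw [← LinearMap.range_eq_top]
    apply span_quot d N hd Y φ h2
    apply chain_coeff Y.α Y.β N _ _ (N + 1) le_rfl
    intro l hl c hc i
    have hb := (Module.finBasis K (new Y.α Y.β l)).sum_repr ⟨c, hc⟩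
    have hb' := congrArg (fun z => (z.1 : ℕ → Y.V2) i) hb
    simp only [Submodule.coe_sum, Submodule.coe_smul, Finset.sum_apply, Pi.smul_apply] at hb'
    rw [← hb']
    refine Submodule.sum_mem _ fun j _ => Submodule.smul_mem _ _ ?_
    have := ofChains_mem Y d' c' hc' (e.symm ⟨⟨l, by omega⟩, j⟩) i
    have hcc : c' (e.symm ⟨⟨l, by omega⟩, j⟩) = (Module.finBasis K (new Y.α Y.β l) j).1 := by
      simp only [c']
      rw [e.apply_symm_apply]
    rw [hcc] at this
    exact this
  have s1 : Function.Surjective ψ.t1 := by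
    intro y
    obtain ⟨x, rfl⟩ := h1 y
    obtain ⟨z, rfl⟩ := sum_alpha_surj d x
    obtain ⟨w, hw⟩ := s2 (φ.t2 z)
    refine ⟨(sumRep fun p => preinj K (d' p)).α w, ?_⟩
    have a := LinearMap.congr_fun ψ.commα w
    have b := LinearMap.congr_fun φ.commα z
    simp only [LinearMap.comp_apply] at a b
    rw [a, b, hw]
  have : FiniteDimensional K (sumRep fun p => preinj K (d' p)).V1 :=
    inferInstanceAs (FiniteDimensional K (∀ p, Fin (d' p) → K))
  have : FiniteDimensional K (sumRep fun p => preinj K (d' p)).V2 :=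
    inferInstanceAs (FiniteDimensional K (∀ p, Fin (d' p + 1) → K))
  have r1 : finrank K (sumRep fun p => preinj K (d' p)).V1 = finrank K Y.V1 := by
    rw [← t1]
    refine Eq.trans (?_ : finrank K (∀ p, Fin (d' p) → K) = _) (hsum fun k => k)
    rw [Module.finrank_pi_fintype]
    simp
  have r2 : finrank K (sumRep fun p => preinj K (d' p)).V2 = finrank K Y.V2 := by
    rw [← t2]
    refine Eq.trans (?_ : finrank K (∀ p, Fin (d' p + 1) → K) = _) (hsum fun k => k + 1)
    rw [Module.finrank_pi_fintype]
    simp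
  refine ⟨_, d', fun p => Nat.lt_succ_iff.mp (e p).1.2, iso_symm ⟨ψ, ⟨?_, s1⟩, ⟨?_, s2⟩⟩⟩
  · exact (LinearMap.injective_iff_surjective_of_finrank_eq_finrank r1).mpr s1
  · exact (LinearMap.injective_iff_surjective_of_finrank_eq_finrank r2).mpr s2

end reps

end KronAux

/-- The additive closure `H = add {(n, n+1) : 0 ≤ n ≤ N}` of preinjective Kronecker modules
is closed under quotients: every quotient of a module in `H` lies in `H` up to
isomorphism. -/
theorem memAddH_closed_under_quotients (N : ℕ) (X Y : KronRep K)
    (hX : memAddH N X) (φ : KronHom X Y)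
    (h1 : Function.Surjective φ.t1) (h2 : Function.Surjective φ.t2) :
    memAddH N Y := by
  obtain ⟨m, d, hd, hiso⟩ := hX
  obtain ⟨ψ, b1, b2⟩ := KronAux.iso_symm hiso
  exact KronAux.main N d hd Y (KronAux.comp φ ψ) (h1.comp b1.surjective) (h2.comp b2.surjective)
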